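/- arXiv:2009.12646 — 4 statements merged into one kernel-verified Lean document; each statement's English description precedes it below -/
import Mathlib

section
/- Assume the poset 𝒜 satisfies condition (a). Let {S_γ}_{γ∈𝒜} be an interaction decomposition of an injective presheaf V over 𝒜, and let F_V be the associated sheaf on X^𝒜. Then F_V is canonically extra-fine; more precisely, F_V is isomorphic to the direct sum of the sheaves F_{S^γ} (γ∈𝒜), and the family of projections onto S_{αβ} := j_{αβ}(S_β) parallel to ⊕_{β'≠β} S_{αβ'} extends to a partition of unity {e_β}_{β∈𝒜} adapted to the canonical covering {U^β}_{β∈𝒜} which, over any open set W, is the projection onto F_{S^β}(W) parallel to ⊕_{β'≠β} F_{S^{β'}}(W). -/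
universe u v

/-- An injective presheaf of `K`-vector spaces over a poset `A`: an arrow `α → β` means
`β ≤ α`, with injective structure map `j h : V β →ₗ[K] V α` for `h : β ≤ α`. -/
structure InjPresheaf (A : Type u) [PartialOrder A] (K : Type v) [Field K] where
  V : A → Type v
  addStr : ∀ α, AddCommGroup (V α)
  modStr : ∀ α, Module K (V α)
  j : ∀ {α β : A}, β ≤ α → V β →ₗ[K] V α
  j_id : ∀ (α : A) (x : V α), j (le_refl α) x = x
  j_comp : ∀ {α β γ : A} (h₁ : γ ≤ β) (h₂ : β ≤ α) (x : V γ), j h₂ (j h₁ x) = j (h₁.trans h₂) x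
  j_inj : ∀ {α β : A} (h : β ≤ α), Function.Injective (j h)

attribute [instance] InjPresheaf.addStr InjPresheaf.modStr

namespace InjPresheaf

variable {A : Type u} [PartialOrder A] {K : Type v} [Field K]

/-- `S` is an interaction decomposition of `W`. -/
def IsInteractionDecomposition (W : InjPresheaf A K) (S : ∀ γ : A, Submodule K (W.V γ)) :
    Prop :=
  ∀ α : A,
    letI : DecidableEq {β : A // β ≤ α} := Classical.decEq _
    DirectSum.IsInternal (fun β : {β : A // β ≤ α} => Submodule.map (W.j β.2) (S β.1))

/-- The subpresheaf `S^γ`: `S^γ(α) = j_{αγ}(S_γ)` if `γ ≤ α`, and `0` otherwise. -/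
noncomputable def Sgamma (W : InjPresheaf A K) (S : ∀ γ : A, Submodule K (W.V γ))
    (γ α : A) : Submodule K (W.V α) :=
  letI : Decidable (γ ≤ α) := Classical.dec _
  if h : γ ≤ α then Submodule.map (W.j h) (S γ) else ⊥

/-- Sections of the sheaf `F_V` on `X^𝒜` over a subset `U` of `A` (intended: an open
upper set): compatible families supported on `U`. -/
def secV (W : InjPresheaf A K) (U : Set A) : Submodule K (∀ α : A, W.V α) where
  carrier := {s | (∀ α : A, α ∉ U → s α = 0) ∧
    ∀ α γ : A, α ∈ U → γ ∈ U → ∀ h : α ≤ γ, W.j h (s α) = s γ}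
  add_mem' := by
    rintro s t ⟨hs0, hs⟩ ⟨ht0, ht⟩
    refine ⟨fun α hα => by simp [hs0 α hα, ht0 α hα], fun α γ hα hγ h => ?_⟩
    simp only [Pi.add_apply, map_add, hs α γ hα hγ h, ht α γ hα hγ h]
  zero_mem' := ⟨fun α _ => rfl, fun α γ _ _ h => by simp⟩
  smul_mem' := by
    rintro c s ⟨hs0, hs⟩
    refine ⟨fun α hα => by simp [hs0 α hα], fun α γ hα hγ h => ?_⟩
    simp only [Pi.smul_apply, map_smul, hs α γ hα hγ h]

/-- Restriction (masking) of sections to a smaller open set. -/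
noncomputable def resSecV (W : InjPresheaf A K) {U U' : Set A} (h : U' ⊆ U)
    (s : W.secV U) : W.secV U' :=
  ⟨fun α => letI := Classical.dec (α ∈ U'); if α ∈ U' then (s : ∀ α : A, W.V α) α else 0,
   by
    constructor
    · intro α hα
      simp only [if_neg hα]
    · intro α γ hα hγ hle
      simp only [if_pos hα, if_pos hγ]
      exact s.2.2 α γ (h hα) (h hγ) hle⟩

/-- An endomorphism of the sheaf `F_V` on `X^𝒜`: an additive family of self-maps of the
spaces of sections over open (upper) sets, natural with respect to restriction. -/
structure SecEndo (W : InjPresheaf A K) where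
  app : ∀ (U : Set A), IsUpperSet U → W.secV U → W.secV U
  app_add : ∀ (U : Set A) (hU : IsUpperSet U) (x y : W.secV U),
    app U hU (x + y) = app U hU x + app U hU y
  naturality : ∀ {U U' : Set A} (hU : IsUpperSet U) (hU' : IsUpperSet U') (h : U' ⊆ U)
    (x : W.secV U), app U' hU' (W.resSecV h x) = W.resSecV h (app U hU x)

/-- The basic open set `U^α = {β | α ≤ β}` of `X^𝒜`. -/
def Uup (α : A) : Set A := {β : A | α ≤ β}

lemma isUpperSet_Uup (α : A) : IsUpperSet (Uup α) := fun _ _ h hb => hb.trans h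

/-- `F_{S^β}(U)`: the subspace of sections over `U` all of whose components lie in the
subpresheaf `S^β`. -/
noncomputable def FSsub (W : InjPresheaf A K) (S : ∀ γ : A, Submodule K (W.V γ))
    (β : A) (U : Set A) : Submodule K (W.secV U) where
  carrier := {s | ∀ α : A, (s : ∀ α : A, W.V α) α ∈ Sgamma W S β α}
  add_mem' := fun {s t} hs ht α => by
    simp only [Submodule.coe_add, Pi.add_apply]
    exact (Sgamma W S β α).add_mem (hs α) (ht α)
  zero_mem' := fun α => by
    simp only [Submodule.coe_zero, Pi.zero_apply]
    exact (Sgamma W S β α).zero_mem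
  smul_mem' := fun c s hs α => by
    simp only [Submodule.coe_smul, Pi.smul_apply]
    exact (Sgamma W S β α).smul_mem c (hs α)

/-- Condition (ii') for a family `{e_β}_{β ∈ 𝒜}` indexed by the canonical covering
`{U^β}` of `X^𝒜`: on every open set, each section is a finite sum of its components. -/
def PartitionII' (W : InjPresheaf A K) (e : A → W.SecEndo) : Prop :=
  ∀ (U : Set A) (hU : IsUpperSet U) (s : W.secV U),
    {β : A | (e β).app U hU s ≠ 0}.Finite ∧ s = ∑ᶠ β : A, (e β).app U hU s

/-- Super-locality (i') with respect to the canonical covering: `e_{β}|_{U^{β'}} ≠ 0`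
implies `U^{β'} ⊆ U^{β}`. -/
def SuperLocal (W : InjPresheaf A K) (e : A → W.SecEndo) : Prop :=
  ∀ β β' : A,
    (∃ s : W.secV (Uup β'), (e β).app (Uup β') (isUpperSet_Uup β') s ≠ 0) →
    Uup β' ⊆ Uup β

/-- Orthogonality (iii): `e_β ∘ e_{β'} = 0` for `β ≠ β'`. -/
def Orthogonal (W : InjPresheaf A K) (e : A → W.SecEndo) : Prop :=
  ∀ β β' : A, β ≠ β' → ∀ (U : Set A) (hU : IsUpperSet U) (s : W.secV U),
    (e β).app U hU ((e β').app U hU s) = 0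

/-- The sheaf `F_V` on `X^𝒜` associated to `W` is canonically extra-fine: there is a
partition of unity adapted to the canonical covering `{U^α}_{α ∈ 𝒜}` which is super-local
and orthogonal. -/
def CanonicallyExtraFine (W : InjPresheaf A K) : Prop :=
  ∃ e : A → W.SecEndo, W.PartitionII' e ∧ W.SuperLocal e ∧ W.Orthogonal e

end InjPresheaf

open InjPresheaf

/-- An internal direct sum decomposition comes with its family of projections. -/
lemma exists_projections_of_iSupIndep {ι R M : Type*} [Ring R] [AddCommGroup M] [Module R M]
    (N : ι → Submodule R M) (hind : iSupIndep N) (htop : iSup N = ⊤) :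
    ∃ p : ι → M →ₗ[R] M, (∀ i x, p i x ∈ N i) ∧ (∀ i, ∀ x ∈ N i, p i x = x) ∧
      (∀ i j, j ≠ i → ∀ x ∈ N j, p i x = 0) ∧
      ∀ x, (Function.support fun i => p i x).Finite ∧ x = ∑ᶠ i, p i x := by
  classical
  let D : DirectSum.Decomposition N :=
    ((DirectSum.isInternal_submodule_iff_iSupIndep_and_iSup_eq_top N).2
      ⟨hind, htop⟩).chooseDecomposition
  refine ⟨fun i => (N i).subtype ∘ₗ DirectSum.component R ι (fun i => N i) i ∘ₗ
    (DirectSum.decomposeLinearEquiv N).toLinearMap, fun i x => Subtype.prop _,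
    fun i x hx => DirectSum.decompose_of_mem_same N hx,
    fun i j hij x hx => DirectSum.decompose_of_mem_ne N hx hij, fun x => ?_⟩
  have hsub : (Function.support fun i => (DirectSum.decompose N x i : M)) ⊆
      ((DirectSum.decompose N x).support : Set ι) := fun i hi => by
    simpa [DFinsupp.mem_support_iff] using hi
  refine ⟨(Finset.finite_toSet _).subset hsub, ?_⟩
  refine (DirectSum.sum_support_decompose N x).symm.trans ?_
  exact (finsum_eq_sum_of_support_subset _ hsub).symm

/-- A family of submodules admitting projections which sum to the identity is an internal
direct sum decomposition. -/
lemma isInternal_of_projections {ι R M : Type*} [DecidableEq ι] [Ring R] [AddCommGroup M]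
    [Module R M] (N : ι → Submodule R M) (p : ι → M →ₗ[R] M) (hmem : ∀ i x, p i x ∈ N i)
    (hid : ∀ i, ∀ x ∈ N i, p i x = x) (hzero : ∀ i j, j ≠ i → ∀ x ∈ N j, p i x = 0)
    (hsum : ∀ x, x = ∑ᶠ i, p i x) : DirectSum.IsInternal N := by
  refine (DirectSum.isInternal_submodule_iff_iSupIndep_and_iSup_eq_top N).2 ⟨?_, ?_⟩
  · intro i
    rw [Submodule.disjoint_def]
    intro x hx hx'
    have hker : (⨆ (j) (_ : j ≠ i), N j) ≤ LinearMap.ker (p i) :=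
      iSup₂_le fun j hj y hy => hzero i j hj y hy
    rw [← hid i x hx]
    exact hker hx'
  · refine eq_top_iff.2 fun x _ => ?_
    rw [hsum x]
    exact finsum_induction (· ∈ iSup N) (zero_mem _) (fun _ _ => add_mem)
      fun i => Submodule.mem_iSup_of_mem i (hmem i x)

namespace InjPresheaf

variable {A : Type u} [PartialOrder A] {K : Type v} [Field K]

lemma Sgamma_of_le (W : InjPresheaf A K) (S : ∀ γ : A, Submodule K (W.V γ)) {γ α : A}
    (h : γ ≤ α) : W.Sgamma S γ α = Submodule.map (W.j h) (S γ) := dif_pos h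

lemma Sgamma_of_not_le (W : InjPresheaf A K) (S : ∀ γ : A, Submodule K (W.V γ)) {γ α : A}
    (h : ¬ γ ≤ α) : W.Sgamma S γ α = ⊥ := dif_neg h

lemma j_mem_Sgamma (W : InjPresheaf A K) (S : ∀ γ : A, Submodule K (W.V γ)) {β α γ : A}
    (h : α ≤ γ) {x : W.V α} (hx : x ∈ W.Sgamma S β α) : W.j h x ∈ W.Sgamma S β γ := by
  by_cases hβ : β ≤ α
  · rw [Sgamma_of_le W S hβ] at hx
    obtain ⟨y, hy, rfl⟩ := hx
    rw [Sgamma_of_le W S (hβ.trans h), W.j_comp]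
    exact Submodule.mem_map_of_mem hy
  · rw [Sgamma_of_not_le W S hβ, Submodule.mem_bot] at hx
    simp [hx]

lemma IsInteractionDecomposition.iSup_Sgamma {W : InjPresheaf A K}
    {S : ∀ γ : A, Submodule K (W.V γ)} (hS : W.IsInteractionDecomposition S) (α : A) :
    ⨆ β, W.Sgamma S β α = ⊤ := by
  let : DecidableEq {β : A // β ≤ α} := Classical.decEq _
  rw [eq_top_iff, ← (hS α).submodule_iSup_eq_top]
  exact iSup_le fun β => (Sgamma_of_le W S β.2).ge.trans (le_iSup (W.Sgamma S · α) β.1)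

lemma IsInteractionDecomposition.iSupIndep_Sgamma {W : InjPresheaf A K}
    {S : ∀ γ : A, Submodule K (W.V γ)} (hS : W.IsInteractionDecomposition S) (α : A) :
    iSupIndep fun β => W.Sgamma S β α := by
  let : DecidableEq {β : A // β ≤ α} := Classical.decEq _
  intro β
  by_cases hβ : β ≤ α
  · refine ((hS α).submodule_iSupIndep ⟨β, hβ⟩).mono (Sgamma_of_le W S hβ).le ?_
    refine iSup₂_le fun γ hγ => ?_
    by_cases hγα : γ ≤ α
    · refine (Sgamma_of_le W S hγα).le.trans ?_
      exact le_iSup₂_of_le (f := fun (δ : {δ : A // δ ≤ α}) (_ : δ ≠ ⟨β, hβ⟩) =>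
        Submodule.map (W.j δ.2) (S δ.1)) ⟨γ, hγα⟩ (fun h => hγ (congrArg Subtype.val h)) le_rfl
    · exact (Sgamma_of_not_le W S hγα).le.trans bot_le
  · simp only [Sgamma_of_not_le W S hβ]
    exact disjoint_bot_left

/-- The action on sections over `U` of an endomorphism `p` of the presheaf `W`. -/
def secMap (W : InjPresheaf A K) (p : ∀ α, W.V α →ₗ[K] W.V α)
    (hp : ∀ {α γ : A} (h : α ≤ γ) (x : W.V α), W.j h (p α x) = p γ (W.j h x)) (U : Set A) :
    W.secV U →ₗ[K] W.secV U :=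
  (LinearMap.pi fun α => p α ∘ₗ LinearMap.proj α).restrict fun s hs =>
    ⟨fun α hα => by simp [hs.1 α hα],
      fun α γ hα hγ h => by simp [hp, hs.2 α γ hα hγ h]⟩

@[simp]
lemma secMap_apply (W : InjPresheaf A K) (p : ∀ α, W.V α →ₗ[K] W.V α)
    (hp : ∀ {α γ : A} (h : α ≤ γ) (x : W.V α), W.j h (p α x) = p γ (W.j h x)) (U : Set A)
    (s : W.secV U) (α : A) : (W.secMap p hp U s).1 α = p α (s.1 α) := rfl

/-- The endomorphism of the sheaf `F_V` induced by an endomorphism of the presheaf `W`. -/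
def secEndo (W : InjPresheaf A K) (p : ∀ α, W.V α →ₗ[K] W.V α)
    (hp : ∀ {α γ : A} (h : α ≤ γ) (x : W.V α), W.j h (p α x) = p γ (W.j h x)) :
    W.SecEndo where
  app U _ := W.secMap p hp U
  app_add U _ := map_add (W.secMap p hp U)
  naturality {U U'} _ _ h x := by
    refine Subtype.ext (funext fun α => ?_)
    by_cases hα : α ∈ U' <;> simp [resSecV, hα]

end InjPresheaf

/-- Assume the poset `𝒜` satisfies condition (a).  If `{S_γ}` is an
interaction decomposition of the injective presheaf `V`, then the associated sheaf `F_V`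
on `X^𝒜` is canonically extra-fine: it decomposes as the direct sum of the sheaves
`F_{S^β}`, and the projections onto `S_{αβ}` parallel to the other summands extend to a
partition of unity `{e_β}_{β ∈ 𝒜}` which, over any open set `W`, is the projection onto
`F_{S^β}(W)` parallel to `⊕_{β' ≠ β} F_{S^{β'}}(W)`. -/
theorem interactionDecomposition_canonicallyExtraFine
    {A : Type u} [PartialOrder A] {K : Type v} [Field K]
    (W : InjPresheaf A K)
    -- condition (a): `𝒜` is lower finitely covered
    (ha : ∃ Ain : Finset A, ∀ β : A, ∃ α ∈ Ain, β ≤ α)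
    (S : ∀ γ : A, Submodule K (W.V γ))
    (hS : W.IsInteractionDecomposition S) :
    ∃ e : A → W.SecEndo,
      W.PartitionII' e ∧ W.SuperLocal e ∧ W.Orthogonal e ∧
      -- `F_V` is the direct sum of the subsheaves `F_{S^β}`
      (∀ (U : Set A) (_ : IsUpperSet U),
        letI : DecidableEq A := Classical.decEq A
        DirectSum.IsInternal (fun β : A => FSsub W S β U)) ∧
      -- over any open set, `e_β` is the projection onto `F_{S^β}` parallel to the
      -- other summands
      (∀ (β : A) (U : Set A) (hU : IsUpperSet U) (s : W.secV U),
        (e β).app U hU s ∈ FSsub W S β U ∧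
        (s ∈ FSsub W S β U → (e β).app U hU s = s) ∧
        (∀ β' : A, β' ≠ β → s ∈ FSsub W S β' U → (e β).app U hU s = 0)) := by
  obtain ⟨Ain, hAin⟩ := ha
  choose p hmem hid hzero hsum using fun α =>
    exists_projections_of_iSupIndep (fun β => W.Sgamma S β α) (hS.iSupIndep_Sgamma α)
      (hS.iSup_Sgamma α)
  have hcomm : ∀ (β : A) {α γ : A} (h : α ≤ γ) (x : W.V α),
      W.j h (p α β x) = p γ β (W.j h x) := by
    intro β α γ h x
    have hx : x ∈ ⨆ δ, W.Sgamma S δ α := by simp [hS.iSup_Sgamma α]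
    induction hx using Submodule.iSup_induction' with
    | mem δ x hx =>
      by_cases hδ : δ = β
      · subst hδ
        rw [hid α δ x hx, hid γ δ _ (W.j_mem_Sgamma S h hx)]
      · rw [hzero α β δ hδ x hx, hzero γ β δ hδ _ (W.j_mem_Sgamma S h hx), map_zero]
    | zero => simp
    | add x y _ _ hx hy => simp only [map_add, hx, hy]
  let P : ∀ (β : A) (U : Set A), W.secV U →ₗ[K] W.secV U := fun β =>
    W.secMap (fun α => p α β) (hcomm β)
  have hPmem : ∀ β U s, P β U s ∈ FSsub W S β U := fun β U s α => hmem α β _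
  have hPid : ∀ β U, ∀ s ∈ FSsub W S β U, P β U s = s := fun β U s hs =>
    Subtype.ext (funext fun α => hid α β _ (hs α))
  have hPzero : ∀ β β' U, β' ≠ β → ∀ s ∈ FSsub W S β' U, P β U s = 0 := fun β β' U h s hs =>
    Subtype.ext (funext fun α => hzero α β β' h _ (hs α))
  have hne : ∀ β U (s : W.secV U), P β U s ≠ 0 → ∃ α ∈ U, p α β (s.1 α) ≠ 0 := by
    intro β U s h
    by_contra! hc
    refine h (Subtype.ext (funext fun α => ?_))
    by_cases hα : α ∈ U
    · exact hc α hα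
    · exact (congrArg (p α β) (s.2.1 α hα)).trans (map_zero _)
  -- By condition (a), every nonzero component of a section is detected on the finite set `Ain`.
  have hfin : ∀ (U : Set A), IsUpperSet U → ∀ s : W.secV U, {β | P β U s ≠ 0}.Finite := by
    intro U hU s
    refine (Ain.finite_toSet.biUnion fun α _ => (hsum α (s.1 α)).1).subset fun β hβ => ?_
    obtain ⟨α, hα, hαβ⟩ := hne β U s hβ
    obtain ⟨γ, hγ, hle⟩ := hAin α
    refine Set.mem_biUnion hγ (show p γ β (s.1 γ) ≠ 0 from ?_)
    rw [← s.2.2 α γ hα (hU hle hα) hle, ← hcomm β hle]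
    exact fun h => hαβ (W.j_inj hle (h.trans (map_zero _).symm))
  have hPsum : ∀ (U : Set A), IsUpperSet U → ∀ s : W.secV U, s = ∑ᶠ β, P β U s := by
    intro U hU s
    refine Subtype.ext (funext fun α => ?_)
    let ev : W.secV U →ₗ[K] W.V α := LinearMap.proj α ∘ₗ (W.secV U).subtype
    exact (hsum α (s.1 α)).2.trans (map_finsum ev (hfin U hU s)).symm
  refine ⟨fun β => W.secEndo (fun α => p α β) (hcomm β),
    fun U hU s => ⟨hfin U hU s, hPsum U hU s⟩, ?_, ?_, ?_, ?_⟩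
  · rintro β β' ⟨s, hs⟩
    obtain ⟨α, hα, hαβ⟩ := hne β _ s hs
    suffices h : β ≤ β' from fun γ hγ => h.trans hγ
    by_contra h
    have hzero' : p β' β (s.1 β') = 0 := by
      have := hmem β' β (s.1 β')
      rwa [Sgamma_of_not_le W S h, Submodule.mem_bot] at this
    have hle : β' ≤ α := hα
    rw [← s.2.2 β' α (le_refl β') hα hle, ← hcomm β, hzero', map_zero] at hαβ
    exact hαβ rfl
  · exact fun β β' h U hU s => hPzero β β' U h.symm _ (hPmem β' U s)
  · intro U hU
    let : DecidableEq A := Classical.decEq A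
    exact isInternal_of_projections (fun β => FSsub W S β U) (fun β => P β U)
      (fun β => hPmem β U) (fun β => hPid β U) (fun β β' => hPzero β β' U) (hPsum U hU)
  · exact fun β U hU s => ⟨hPmem β U s, hPid β U s, fun β' h => hPzero β β' U h s⟩
end

section
/- Let V be an injective presheaf over a poset 𝒜 with values in vector spaces over a field K. (1) If V satisfies condition (G) and 𝒜 has locally finite lower dimension, then V admits an interaction decomposition. (2) If V admits an interaction decomposition, then V satisfies condition (G). -/
universe u v

namespace InjPresheaf

variable {A : Type u} [PartialOrder A] {K : Type v} [Field K]

/-- `V_{αβ} = j_{αβ}(V_β)`, the image of `V β` in `V α`. -/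
def Vsub (W : InjPresheaf A K) {α β : A} (h : β ≤ α) : Submodule K (W.V α) :=
  LinearMap.range (W.j h)

/-- Condition (G), the sum-intersection condition: for every arrow `α → β` (i.e. `β ≤ α`),
`V_{αβ} ∩ (Σ_{γ : α→γ, γ≠α, ¬(γ→β)} V_{αγ}) ⊆ Σ_{γ' : α→γ', γ'≠α, β→γ', γ'≠β} V_{αγ'}`. -/
def ConditionG (W : InjPresheaf A K) : Prop :=
  ∀ α β : A, ∀ h : β ≤ α,
    W.Vsub h ⊓ (⨆ (γ : A) (hγ : γ ≤ α ∧ γ ≠ α ∧ ¬ β ≤ γ), W.Vsub hγ.1)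
      ≤ ⨆ (γ' : A) (hγ' : γ' ≤ α ∧ γ' ≠ α ∧ γ' ≤ β ∧ γ' ≠ β), W.Vsub hγ'.1

end InjPresheaf

/-- The poset `A` has locally finite (lower) dimension: for every `α`, the non-degenerate
descending chains starting at `α` are finite of uniformly bounded length. -/
def LocallyFiniteDimension (A : Type u) [PartialOrder A] : Prop :=
  ∀ α : A, ∃ n : ℕ, ∀ (m : ℕ) (c : Fin (m + 1) → A), c 0 = α → StrictAnti c → m ≤ n

namespace InjPresheaf

variable {A : Type u} [PartialOrder A] {K : Type v} [Field K]

/-- The sum of the images in `V α` of all the spaces `V γ` with `γ < α`. -/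
def lowerSum (W : InjPresheaf A K) (α : A) : Submodule K (W.V α) :=
  ⨆ (γ : A) (h : γ < α), W.Vsub h.le

theorem isInteractionDecomposition_iff (W : InjPresheaf A K)
    {S : ∀ γ : A, Submodule K (W.V γ)} :
    W.IsInteractionDecomposition S ↔ ∀ α : A,
      iSupIndep (fun β : {β : A // β ≤ α} => (S β.1).map (W.j β.2)) ∧
        ⨆ β : {β : A // β ≤ α}, (S β.1).map (W.j β.2) = ⊤ :=
  forall_congr' fun α =>
    letI : DecidableEq {β : A // β ≤ α} := Classical.decEq _
    DirectSum.isInternal_submodule_iff_iSupIndep_and_iSup_eq_top _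

theorem map_Vsub (W : InjPresheaf A K) {α β γ : A} (h₁ : γ ≤ β) (h₂ : β ≤ α) :
    (W.Vsub h₁).map (W.j h₂) = W.Vsub (h₁.trans h₂) := by
  rw [Vsub, Vsub, ← LinearMap.range_comp]
  congr 1
  ext x
  exact W.j_comp h₁ h₂ x

theorem map_j_map_j (W : InjPresheaf A K) {α β γ : A} (h₁ : γ ≤ β) (h₂ : β ≤ α)
    (S : Submodule K (W.V γ)) :
    (S.map (W.j h₁)).map (W.j h₂) = S.map (W.j (h₁.trans h₂)) := by
  rw [← Submodule.map_comp]
  congr 1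
  ext x
  exact W.j_comp h₁ h₂ x

theorem map_j_refl (W : InjPresheaf A K) (α : A) (S : Submodule K (W.V α)) :
    S.map (W.j le_rfl) = S := by
  rw [show W.j (le_refl α) = LinearMap.id from LinearMap.ext (W.j_id α), Submodule.map_id]

theorem map_lowerSum (W : InjPresheaf A K) {α β : A} (h : β ≤ α) :
    (W.lowerSum β).map (W.j h) =
      ⨆ (γ : A) (hγ : γ ≤ α ∧ γ ≠ α ∧ γ ≤ β ∧ γ ≠ β), W.Vsub hγ.1 := by
  simp only [lowerSum, Submodule.map_iSup, map_Vsub]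
  refine iSup_congr fun γ => le_antisymm ?_ ?_
  · exact iSup_le fun hγ =>
      le_iSup_of_le ⟨hγ.le.trans h, (hγ.trans_le h).ne, hγ.le, hγ.ne⟩ le_rfl
  · exact iSup_le fun hγ => le_iSup_of_le (lt_of_le_of_ne hγ.2.2.1 hγ.2.2.2) le_rfl

/-- If the `S γ` complement the lower sums and the order is well-founded, the images of the
`S γ` span. -/
theorem iSup_map_eq_top [WellFoundedLT A] (W : InjPresheaf A K)
    {S : ∀ γ : A, Submodule K (W.V γ)} (hS : ∀ α, Codisjoint (W.lowerSum α) (S α)) (α : A) :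
    ⨆ β : {β : A // β ≤ α}, (S β.1).map (W.j β.2) = ⊤ := by
  induction α using WellFoundedLT.induction with
  | ind α ih =>
    rw [eq_top_iff, ← (hS α).eq_top]
    refine sup_le (iSup₂_le fun γ hγ => ?_) ?_
    · rw [Vsub, LinearMap.range_eq_map, ← ih γ hγ, Submodule.map_iSup]
      refine iSup_le fun β => ?_
      rw [map_j_map_j]
      exact le_iSup (fun β : {β : A // β ≤ α} => (S β.1).map (W.j β.2)) ⟨β.1, β.2.trans hγ.le⟩
    · refine le_trans (W.map_j_refl α (S α)).ge ?_
      exact le_iSup (fun β : {β : A // β ≤ α} => (S β.1).map (W.j β.2)) ⟨α, le_rfl⟩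

/-- Under condition (G), subspaces disjoint from the lower sums have independent images. -/
theorem ConditionG.iSupIndep_map {W : InjPresheaf A K} (hG : W.ConditionG)
    {S : ∀ γ : A, Submodule K (W.V γ)} (hS : ∀ α, Disjoint (W.lowerSum α) (S α)) (α : A) :
    iSupIndep fun β : {β : A // β ≤ α} => (S β.1).map (W.j β.2) := by
  classical
  rw [iSupIndep_iff_finsetSum_eq_zero_imp_eq_zero]
  intro s v hv hsum
  by_contra! hne
  obtain ⟨β, hβ⟩ := (s.filter fun i => v i ≠ 0).exists_maximal
    (by obtain ⟨i, hi, h0⟩ := hne; exact ⟨i, Finset.mem_filter.2 ⟨hi, h0⟩⟩)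
  obtain ⟨hβs, hβ0⟩ := Finset.mem_filter.1 hβ.prop
  obtain ⟨x, hxS, hx⟩ := hv β hβs
  have hmem : v β ∈ ⨆ (γ : A) (hγ : γ ≤ α ∧ γ ≠ α ∧ ¬ β.1 ≤ γ), W.Vsub hγ.1 := by
    rw [← Finset.add_sum_erase s v hβs] at hsum
    rw [eq_neg_of_add_eq_zero_left hsum]
    refine neg_mem (sum_mem fun i hi => ?_)
    obtain ⟨hiβ, his⟩ := Finset.mem_erase.1 hi
    by_cases hi0 : v i = 0
    · rw [hi0]; exact zero_mem _
    have hnle : ¬ β.1 ≤ i.1 := fun hle =>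
      hiβ (le_antisymm (hβ.le_of_ge (Finset.mem_filter.2 ⟨his, hi0⟩) hle) hle)
    refine Submodule.mem_iSup_of_mem i.1 (Submodule.mem_iSup_of_mem
      ⟨i.2, fun h => hnle (β.2.trans h.ge), hnle⟩ ?_)
    exact LinearMap.map_le_range (hv i his)
  have hlow := hG α β.1 β.2 ⟨⟨x, hx⟩, hmem⟩
  rw [← W.map_lowerSum β.2] at hlow
  obtain ⟨y, hy, hyx⟩ := hlow
  obtain rfl : y = x := W.j_inj β.2 (hyx.trans hx.symm)
  rw [Submodule.disjoint_def.1 (hS β.1) y hy hxS, map_zero] at hx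
  exact hβ0 hx.symm

theorem IsInteractionDecomposition.conditionG {W : InjPresheaf A K}
    {S : ∀ γ : A, Submodule K (W.V γ)} (hS : W.IsInteractionDecomposition S) :
    W.ConditionG := by
  have key := W.isInteractionDecomposition_iff.1 hS
  have hspan (α : A) : S α ⊔ W.lowerSum α = ⊤ := by
    rw [eq_top_iff, ← (key α).2]
    refine iSup_le fun β => ?_
    obtain ⟨β, hβ⟩ := β
    obtain rfl | hlt := hβ.eq_or_lt
    · exact le_sup_of_le_left (W.map_j_refl _ _).le
    · exact le_sup_of_le_right (le_iSup₂_of_le β hlt LinearMap.map_le_range)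
  rintro α β h x ⟨⟨b, rfl⟩, hx⟩
  obtain ⟨s, hs, y, hy, rfl⟩ := Submodule.mem_sup.1 (hspan β ▸ Submodule.mem_top : b ∈ _)
  have hle (γ : A) (hγ : γ ≤ α) (hβγ : ¬ β ≤ γ) : W.Vsub hγ ≤
      ⨆ (δ : {δ : A // δ ≤ α}) (_ : δ ≠ ⟨β, h⟩), (S δ.1).map (W.j δ.2) := by
    rw [Vsub, LinearMap.range_eq_map, ← (key γ).2, Submodule.map_iSup]
    refine iSup_le fun δ => ?_
    rw [map_j_map_j]
    refine le_iSup₂_of_le (f := fun (δ : {δ : A // δ ≤ α}) (_ : δ ≠ ⟨β, h⟩) =>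
      (S δ.1).map (W.j δ.2)) ⟨δ.1, δ.2.trans hγ⟩ (fun he => hβγ ?_) le_rfl
    exact (congrArg Subtype.val he).ge.trans δ.2
  have hylow : W.j h y ∈ (W.lowerSum β).map (W.j h) := ⟨y, hy, rfl⟩
  have hs0 : W.j h s = 0 := by
    refine Submodule.disjoint_def.1 ((key α).1 ⟨β, h⟩) _ ⟨s, hs, rfl⟩ ?_
    rw [show W.j h s = W.j h (s + y) - W.j h y by simp]
    refine sub_mem (iSup₂_le (fun γ hγ => hle γ hγ.1 hγ.2.2) hx) ?_
    rw [map_lowerSum] at hylow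
    exact iSup₂_le (fun γ hγ => hle γ hγ.1
      fun hβγ => hγ.2.2.2 (le_antisymm hγ.2.2.1 hβγ)) hylow
  rw [map_add, hs0, zero_add, ← map_lowerSum]
  exact hylow

end InjPresheaf

theorem LocallyFiniteDimension.wellFoundedLT {A : Type u} [PartialOrder A]
    (hA : LocallyFiniteDimension A) : WellFoundedLT A := by
  refine ⟨RelEmbedding.wellFounded_iff_isEmpty.2 ⟨fun f => ?_⟩⟩
  obtain ⟨n, hn⟩ := hA (f 0)
  have := hn (n + 1) (fun i => f i) rfl fun i k hik => f.map_rel_iff.2 hik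
  omega

/-- For an injective presheaf `V` of vector spaces over a poset `𝒜`:
(1) if `V` satisfies condition (G) and `𝒜` has locally finite lower dimension, then `V`
admits an interaction decomposition; (2) if `V` admits an interaction decomposition, then
`V` satisfies condition (G). -/
theorem conditionG_iff_interactionDecomposition
    {A : Type u} [PartialOrder A] {K : Type v} [Field K]
    (W : InjPresheaf A K) :
    (W.ConditionG → LocallyFiniteDimension A →
      ∃ S : ∀ γ : A, Submodule K (W.V γ), W.IsInteractionDecomposition S) ∧
    ((∃ S : ∀ γ : A, Submodule K (W.V γ), W.IsInteractionDecomposition S) →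
      W.ConditionG) := by
  refine ⟨fun hG hA => ?_, fun ⟨_, hS⟩ => hS.conditionG⟩
  have := hA.wellFoundedLT
  choose S hS using fun α => (W.lowerSum α).exists_isCompl
  exact ⟨S, W.isInteractionDecomposition_iff.2 fun α =>
    ⟨hG.iSupIndep_map (fun α => (hS α).disjoint) α,
      W.iSup_map_eq_top (fun α => (hS α).codisjoint) α⟩⟩
end

section
/- Let 𝒰 be an open covering of a topological space X that refines an open covering 𝒰′. Then any two projections λ, μ : 𝒰 → 𝒰′ induce simplicially homotopic simplicial maps λ_*, μ_* : K(𝒰) → K(𝒰′) between the nerves of the coverings. -/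
open TopologicalSpace

universe u

/-- A simplicial set, described by its values on the objects `[n]` of the simplex
category and the action of nondecreasing maps. -/
structure SimpSet where
  obj : ℕ → Type u
  map : ∀ {m n : ℕ}, (Fin (m + 1) →o Fin (n + 1)) → obj n → obj m
  map_id : ∀ (n : ℕ) (x : obj n), map (OrderHom.id : Fin (n + 1) →o Fin (n + 1)) x = x
  map_comp : ∀ {m n p : ℕ} (φ : Fin (m + 1) →o Fin (n + 1)) (ψ : Fin (n + 1) →o Fin (p + 1))
    (x : obj p), map φ (map ψ x) = map (ψ.comp φ) x

/-- A morphism of simplicial sets. -/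
structure SimpMap (S T : SimpSet) where
  app : ∀ n : ℕ, S.obj n → T.obj n
  naturality : ∀ {m n : ℕ} (φ : Fin (m + 1) →o Fin (n + 1)) (x : S.obj n),
    app m (S.map φ x) = T.map φ (app n x)

/-- The product of two simplicial sets (objectwise). -/
def SimpSet.prod (S T : SimpSet) : SimpSet where
  obj n := S.obj n × T.obj n
  map φ x := (S.map φ x.1, T.map φ x.2)
  map_id n x := by cases x; simp only [S.map_id, T.map_id]
  map_comp φ ψ x := by cases x; simp only [S.map_comp, T.map_comp]

/-- The standard 1-simplex `Δ¹` as a simplicial set: `Δ¹_n = Hom([n], [1])`. -/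
def Delta1 : SimpSet where
  obj n := Fin (n + 1) →o Fin 2
  map φ f := f.comp φ
  map_id _ _ := rfl
  map_comp _ _ _ := rfl

/-- A simplicial homotopy from `f` to `g`: a simplicial map `h : K × Δ¹ → L` restricting
to `f` and `g` on the two ends of the cylinder. -/
structure SimpHomotopy {S T : SimpSet} (f g : SimpMap S T) where
  h : SimpMap (S.prod Delta1) T
  h_zero : ∀ (n : ℕ) (x : S.obj n),
    h.app n (x, (OrderHom.const _ (0 : Fin 2) : Fin (n + 1) →o Fin 2)) = f.app n x
  h_one : ∀ (n : ℕ) (x : S.obj n),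
    h.app n (x, (OrderHom.const _ (1 : Fin 2) : Fin (n + 1) →o Fin 2)) = g.app n x

variable {X : Type u} [TopologicalSpace X]

/-- The nerve `K(𝒰)` of an open covering `𝒰`: its `n`-simplices are the `(n+1)`-tuples of
elements of `𝒰` with nonempty intersection. -/
def nerveCov (𝒰 : Set (Opens X)) : SimpSet where
  obj n := {u : Fin (n + 1) → Opens X // (∀ i, u i ∈ 𝒰) ∧ (⋂ i, (u i : Set X)).Nonempty}
  map φ u := ⟨u.1 ∘ φ, fun i => u.2.1 _,
    u.2.2.mono (Set.iInter_mono' fun j => ⟨φ j, subset_rfl⟩)⟩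
  map_id _ _ := Subtype.ext rfl
  map_comp _ _ _ := Subtype.ext rfl

/-- The simplicial map `λ_* : K(𝒰) → K(𝒰')` induced by a projection `λ : 𝒰 → 𝒰'`
(a map with `U ⊆ λ(U)` witnessing that `𝒰` refines `𝒰'`). -/
def projMap {𝒰 𝒰' : Set (Opens X)} (l : Opens X → Opens X)
    (hl : ∀ U ∈ 𝒰, l U ∈ 𝒰' ∧ U ≤ l U) : SimpMap (nerveCov 𝒰) (nerveCov 𝒰') where
  app n u := ⟨l ∘ u.1, fun i => (hl _ (u.2.1 i)).1,
    u.2.2.mono (Set.iInter_mono' fun i =>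
      ⟨i, SetLike.coe_subset_coe.mpr (hl _ (u.2.1 i)).2⟩)⟩
  naturality _ _ := Subtype.ext rfl

/-- If the open covering `𝒰` refines `𝒰'`, then any two projections
`λ, μ : 𝒰 → 𝒰'` induce simplicially homotopic simplicial maps
`λ_*, μ_* : K(𝒰) → K(𝒰')`. -/
theorem projections_simplicially_homotopic {𝒰 𝒰' : Set (Opens X)}
    (l m : Opens X → Opens X)
    (hl : ∀ U ∈ 𝒰, l U ∈ 𝒰' ∧ U ≤ l U) (hm : ∀ U ∈ 𝒰, m U ∈ 𝒰' ∧ U ≤ m U) :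
    Nonempty (SimpHomotopy (projMap l hl) (projMap m hm)) := by
  have hp : ∀ (b : Fin 2), ∀ U ∈ 𝒰, (if b = 0 then l U else m U) ∈ 𝒰' ∧
      U ≤ (if b = 0 then l U else m U) := by
    intro b U hU
    split_ifs
    exacts [hl U hU, hm U hU]
  exact ⟨{
    h := {
      app := fun _ x => ⟨fun i => if OrderHom.toFun x.2 i = 0 then l (x.1.1 i) else m (x.1.1 i),
        fun i => (hp (OrderHom.toFun x.2 i) _ (x.1.2.1 i)).1,
        x.1.2.2.mono (Set.iInter_mono fun i =>
          SetLike.coe_subset_coe.mpr (hp (OrderHom.toFun x.2 i) _ (x.1.2.1 i)).2)⟩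
      naturality := fun _ _ => Subtype.ext rfl }
    h_zero := fun _ _ => Subtype.ext rfl
    h_one := fun _ _ => Subtype.ext rfl }⟩
end

section
/- Let 𝒰 be an open covering of a topological space X and F a presheaf of abelian groups on X. Let π : 𝒜(𝒰) → 𝒰 be any map with V ⊆ π(V) for all V ∈ 𝒜(𝒰) and π(U) = U for U ∈ 𝒰, let π_* : N(𝒰) → K(𝒰) be the induced simplicial map, and let π* : C^•(K(𝒰);F^∨) → C^•(N(𝒰);F_*) be the induced chain map. Then π* is a homotopy equivalence of cochain complexes: there exists a chain map Sd^• : C^•(N(𝒰);F_*) → C^•(K(𝒰);F^∨) such that both Sd^•∘π* and π*∘Sd^• are chain homotopic to the respective identities; in particular π* induces an isomorphism in cohomology. -/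
open TopologicalSpace

universe u v

/-- A presheaf of abelian groups on a topological space. -/
structure Presheaf' (X : Type u) [TopologicalSpace X] where
  obj : Opens X → Type v
  addStr : ∀ U, AddCommGroup (obj U)
  res : ∀ {U V : Opens X}, V ≤ U → obj U → obj V
  res_add : ∀ {U V : Opens X} (h : V ≤ U) (x y : obj U), res h (x + y) = res h x + res h y
  res_id : ∀ {U : Opens X} (x : obj U), res (le_refl U) x = x
  res_comp : ∀ {U V W : Opens X} (h₁ : V ≤ U) (h₂ : W ≤ V) (x : obj U),
    res h₂ (res h₁ x) = res (h₂.trans h₁) x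

attribute [instance] Presheaf'.addStr

variable {X : Type u} [TopologicalSpace X]

/-! ### The Čech complex of the nerve `K(𝒰)` of a covering, with the Čech local
system `F^∨` -/

/-- The `n`-simplices of the nerve `K(𝒰)`. -/
def KSimplex (𝒰 : Set (Opens X)) (n : ℕ) : Type u :=
  {u : Fin (n + 1) → Opens X // (∀ i, u i ∈ 𝒰) ∧ (⋂ i, (u i : Set X)).Nonempty}

/-- Čech cochains: `C^n(K(𝒰); F^∨)`. -/
def KCochain (F : Presheaf'.{u, v} X) (𝒰 : Set (Opens X)) (n : ℕ) : Type (max u v) :=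
  ∀ u : KSimplex 𝒰 n, F.obj (⨅ i, u.1 i)

noncomputable instance (F : Presheaf'.{u, v} X) (𝒰 : Set (Opens X)) (n : ℕ) :
    AddCommGroup (KCochain F 𝒰 n) := Pi.addCommGroup

/-- The `i`-th face of a simplex of `K(𝒰)`. -/
def kface {𝒰 : Set (Opens X)} {n : ℕ} (u : KSimplex 𝒰 (n + 1)) (i : Fin (n + 2)) :
    KSimplex 𝒰 n :=
  ⟨u.1 ∘ i.succAbove, ⟨fun _ => u.2.1 _,
    u.2.2.mono (Set.iInter_mono' fun j => ⟨i.succAbove j, subset_rfl⟩)⟩⟩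

lemma iInf_le_kface {𝒰 : Set (Opens X)} {n : ℕ} (u : KSimplex 𝒰 (n + 1))
    (i : Fin (n + 2)) : (⨅ k, u.1 k) ≤ ⨅ j, (kface u i).1 j :=
  le_iInf fun _ => iInf_le u.1 _

/-- The Čech coboundary of `C^•(K(𝒰); F^∨)`. -/
noncomputable def deltaK (F : Presheaf'.{u, v} X) (𝒰 : Set (Opens X)) (n : ℕ)
    (c : KCochain F 𝒰 n) : KCochain F 𝒰 (n + 1) :=
  fun u => ∑ i : Fin (n + 2),
    ((-1 : ℤ) ^ (i : ℕ)) • F.res (iInf_le_kface u i) (c (kface u i))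

/-! ### The complex of the nerve `N(𝒰)` of the category `𝒜(𝒰)` of nonempty finite
intersections, with the lower local system `F_*` -/

/-- Membership in `𝒜(𝒰)`: `V` is a nonempty finite intersection of elements of `𝒰`. -/
def memA (𝒰 : Set (Opens X)) (V : Opens X) : Prop :=
  (∃ s : Finset (Opens X), ↑s ⊆ 𝒰 ∧ s.Nonempty ∧ V = s.inf id) ∧ (V : Set X).Nonempty

/-- The `n`-simplices of `N(𝒰)` (the nerve of the category `𝒜(𝒰)`, whose arrows are the
inclusions `V → V'` for `V ⊆ V'`): chains `V_0 → V_1 → ⋯ → V_n`. -/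
def NSimplex (𝒰 : Set (Opens X)) (n : ℕ) : Type u :=
  {v : Fin (n + 1) → Opens X // (∀ i, memA 𝒰 (v i)) ∧ Monotone v}

/-- Cochains of `N(𝒰)` with values in the lower local system `F_*`
(which assigns `F(V_0)` to the chain `V_0 → ⋯ → V_n`). -/
def NCochain (F : Presheaf'.{u, v} X) (𝒰 : Set (Opens X)) (n : ℕ) : Type (max u v) :=
  ∀ v : NSimplex 𝒰 n, F.obj (v.1 0)

noncomputable instance (F : Presheaf'.{u, v} X) (𝒰 : Set (Opens X)) (n : ℕ) :
    AddCommGroup (NCochain F 𝒰 n) := Pi.addCommGroup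

/-- The `i`-th face of a simplex of `N(𝒰)`. -/
def nface {𝒰 : Set (Opens X)} {n : ℕ} (v : NSimplex 𝒰 (n + 1)) (i : Fin (n + 2)) :
    NSimplex 𝒰 n :=
  ⟨v.1 ∘ i.succAbove, ⟨fun _ => v.2.1 _,
    v.2.2.comp (Fin.strictMono_succAbove i).monotone⟩⟩

lemma nface_zero_le {𝒰 : Set (Opens X)} {n : ℕ} (v : NSimplex 𝒰 (n + 1))
    (i : Fin (n + 2)) : v.1 0 ≤ (nface v i).1 0 :=
  v.2.2 (Fin.zero_le _)

/-- The coboundary of `C^•(N(𝒰); F_*)` (for `i ≥ 1` the restriction map below is the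
identity, since then `(d_i v)_0 = v_0`; for `i = 0` it is the structure map
`F(V_1) → F(V_0)` of the lower local system). -/
noncomputable def deltaN (F : Presheaf'.{u, v} X) (𝒰 : Set (Opens X)) (n : ℕ)
    (c : NCochain F 𝒰 n) : NCochain F 𝒰 (n + 1) :=
  fun v => ∑ i : Fin (n + 2),
    ((-1 : ℤ) ^ (i : ℕ)) • F.res (nface_zero_le v i) (c (nface v i))

/-! ### The comparison map `π^*` -/

section Pi

variable {𝒰 : Set (Opens X)} (p : Opens X → Opens X)
  (hp : ∀ V : Opens X, memA 𝒰 V → p V ∈ 𝒰 ∧ V ≤ p V)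

/-- The simplicial map `π_* : N(𝒰) → K(𝒰)` induced by a projection
`π : 𝒜(𝒰) → 𝒰`. -/
def piSimp {n : ℕ} (v : NSimplex 𝒰 n) : KSimplex 𝒰 n :=
  ⟨p ∘ v.1, ⟨fun i => (hp _ (v.2.1 i)).1, by
    obtain ⟨x, hx⟩ := (v.2.1 0).2
    exact ⟨x, Set.mem_iInter.2 fun i =>
      ((v.2.2 (Fin.zero_le i)).trans (hp _ (v.2.1 i)).2) hx⟩⟩⟩

lemma le_iInf_piSimp {n : ℕ} (v : NSimplex 𝒰 n) : v.1 0 ≤ ⨅ i, (piSimp p hp v).1 i :=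
  le_iInf fun i => (v.2.2 (Fin.zero_le i)).trans (hp _ (v.2.1 i)).2

/-- The chain map `π^* : C^•(K(𝒰); F^∨) → C^•(N(𝒰); F_*)` induced by the lift of `π_*`
given by the restriction maps
`F(π(V_0) ∩ … ∩ π(V_n)) → F(V_0)`. -/
noncomputable def piStar (F : Presheaf'.{u, v} X) (n : ℕ) (c : KCochain F 𝒰 n) :
    NCochain F 𝒰 n :=
  fun v => F.res (le_iInf_piSimp p hp v) (c (piSimp p hp v))

end Pi

/-! ### Ordered chains on a type -/

/-- The augmented ordered chains on `α`, indexed by the number of vertices. -/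
abbrev TupleChain (α : Type*) (n : ℕ) : Type _ := (Fin n → α) →₀ ℤ

namespace TupleChain

variable {α : Type*}

/-- The augmented boundary of ordered chains. -/
noncomputable def bd (n : ℕ) : TupleChain α (n + 1) →ₗ[ℤ] TupleChain α n :=
  Finsupp.linearCombination ℤ fun s =>
    ∑ i : Fin (n + 1), ((-1 : ℤ) ^ (i : ℕ)) • Finsupp.single (s ∘ i.succAbove) (1 : ℤ)

/-- The cone with apex `a`, placed as first vertex. -/
noncomputable def cone (a : α) (n : ℕ) : TupleChain α n →ₗ[ℤ] TupleChain α (n + 1) :=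
  Finsupp.linearCombination ℤ fun s => Finsupp.single (Fin.cons a s : Fin (n + 1) → α) (1 : ℤ)

/-- The map of chains induced by a map of vertices. -/
noncomputable def map (p : α → α) (n : ℕ) : TupleChain α n →ₗ[ℤ] TupleChain α n :=
  Finsupp.linearCombination ℤ fun s => Finsupp.single (p ∘ s) (1 : ℤ)

@[simp] lemma bd_single (n : ℕ) (s : Fin (n + 1) → α) :
    bd n (Finsupp.single s 1) =
      ∑ i : Fin (n + 1), ((-1 : ℤ) ^ (i : ℕ)) • Finsupp.single (s ∘ i.succAbove) (1 : ℤ) := by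
  simp [bd]

@[simp] lemma cone_single (a : α) (n : ℕ) (s : Fin n → α) :
    cone a n (Finsupp.single s 1) = Finsupp.single (Fin.cons a s : Fin (n + 1) → α) 1 := by
  simp [cone]

@[simp] lemma map_single (p : α → α) (n : ℕ) (s : Fin n → α) :
    map p n (Finsupp.single s 1) = Finsupp.single (p ∘ s) 1 := by
  simp [map]

/-- Linear maps out of chains agree if they agree on simplices. -/
lemma hom_ext {n : ℕ} {M : Type*} [AddCommGroup M] {f g : TupleChain α n →ₗ[ℤ] M}
    (h : ∀ s, f (Finsupp.single s 1) = g (Finsupp.single s 1)) : f = g :=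
  Finsupp.lhom_ext' fun s => LinearMap.ext_ring (h s)

lemma bd_cone_zero (a : α) : bd 0 ∘ₗ cone a 0 = LinearMap.id := by
  refine hom_ext fun s => ?_
  simp [Subsingleton.elim _ s]

lemma cons_comp_succAbove_succ (a : α) {n : ℕ} (s : Fin (n + 1) → α) (i : Fin (n + 1)) :
    (Fin.cons a s : Fin (n + 2) → α) ∘ i.succ.succAbove = Fin.cons a (s ∘ i.succAbove) := by
  funext j
  cases j using Fin.cases <;> simp

lemma bd_cone (a : α) (n : ℕ) :
    bd (n + 1) ∘ₗ cone a (n + 1) = LinearMap.id - cone a n ∘ₗ bd n := by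
  refine hom_ext fun s => ?_
  have h0 : (Fin.cons a s : Fin (n + 2) → α) ∘ Fin.succ = s := by
    funext j
    simp
  simp only [LinearMap.comp_apply, cone_single, bd_single, LinearMap.sub_apply,
    LinearMap.id_apply, map_sum, map_smul]
  rw [Fin.sum_univ_succ]
  simp only [cons_comp_succAbove_succ, Fin.val_zero, pow_zero, one_smul, Fin.val_succ, pow_succ,
    Fin.succAbove_zero, h0, mul_neg, mul_one, neg_smul, Finset.sum_neg_distrib, sub_eq_add_neg]

lemma bd_comp_bd (n : ℕ) : bd n ∘ₗ bd (n + 1) = (0 : TupleChain α (n + 2) →ₗ[ℤ] _) := by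
  have key (m : ℕ) (s : Fin (m + 1) → α) : (Finsupp.single s 1 : TupleChain α (m + 1)) =
      cone (s 0) m (Finsupp.single (Fin.tail s) 1) := by
    rw [cone_single, Fin.cons_self_tail]
  induction n with
  | zero =>
    refine hom_ext fun s => ?_
    rw [key, LinearMap.comp_apply, ← LinearMap.comp_apply (bd 1), bd_cone, LinearMap.sub_apply,
      map_sub, LinearMap.comp_apply, ← LinearMap.comp_apply (bd 0) (cone _ _), bd_cone_zero]
    simp
  | succ n ih =>
    refine hom_ext fun s => ?_
    rw [key, LinearMap.comp_apply, ← LinearMap.comp_apply (bd (n + 2)), bd_cone,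
      LinearMap.sub_apply, map_sub, LinearMap.comp_apply,
      ← LinearMap.comp_apply (bd (n + 1)) (cone _ _), bd_cone, LinearMap.sub_apply,
      LinearMap.comp_apply (cone _ _), ← LinearMap.comp_apply (bd n), ih]
    simp

lemma bd_comp_map (p : α → α) (n : ℕ) : bd n ∘ₗ map p (n + 1) = map p n ∘ₗ bd n := by
  refine hom_ext fun s => ?_
  simp only [LinearMap.comp_apply, map_single, bd_single, map_sum, map_smul,
    Function.comp_assoc]

lemma map_zero_eq_id (p : α → α) : map p 0 = LinearMap.id := by
  refine hom_ext fun s => ?_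
  simp [Subsingleton.elim _ s]

/-- Coning the values of `g`, the apex `a s` depending on the source simplex `s`. -/
noncomputable def coneHom {n : ℕ} (a : (Fin n → α) → α) {m : ℕ}
    (g : TupleChain α n →ₗ[ℤ] TupleChain α m) : TupleChain α n →ₗ[ℤ] TupleChain α (m + 1) :=
  Finsupp.linearCombination ℤ fun s => cone (a s) m (g (Finsupp.single s 1))

lemma coneHom_single {n : ℕ} (a : (Fin n → α) → α) {m : ℕ}
    (g : TupleChain α n →ₗ[ℤ] TupleChain α m) (s : Fin n → α) :
    coneHom a g (Finsupp.single s 1) = cone (a s) m (g (Finsupp.single s 1)) := by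
  simp [coneHom]

lemma bd_comp_coneHom_zero {n : ℕ} (a : (Fin n → α) → α)
    (g : TupleChain α n →ₗ[ℤ] TupleChain α 0) : bd 0 ∘ₗ coneHom a g = g := by
  refine hom_ext fun s => ?_
  rw [LinearMap.comp_apply, coneHom_single, ← LinearMap.comp_apply, bd_cone_zero,
    LinearMap.id_apply]

lemma bd_comp_coneHom {n : ℕ} (a : (Fin n → α) → α) {m : ℕ}
    (g : TupleChain α n →ₗ[ℤ] TupleChain α (m + 1)) (hg : bd m ∘ₗ g = 0) :
    bd (m + 1) ∘ₗ coneHom a g = g := by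
  refine hom_ext fun s => ?_
  rw [LinearMap.comp_apply, coneHom_single, ← LinearMap.comp_apply, bd_cone,
    LinearMap.sub_apply, LinearMap.id_apply, LinearMap.comp_apply, ← LinearMap.comp_apply (bd m),
    hg]
  simp

/-- The subdivision operator with apices `a`: iterated cones over the boundary. -/
noncomputable def sd (a : ∀ n, (Fin (n + 1) → α) → α) :
    ∀ n, TupleChain α n →ₗ[ℤ] TupleChain α n
  | 0 => LinearMap.id
  | n + 1 => coneHom (a n) (sd a n ∘ₗ bd n)

lemma bd_comp_sd (a : ∀ n, (Fin (n + 1) → α) → α) (n : ℕ) :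
    bd n ∘ₗ sd a (n + 1) = sd a n ∘ₗ bd n := by
  induction n with
  | zero => exact bd_comp_coneHom_zero _ _
  | succ n ih =>
    refine bd_comp_coneHom _ _ ?_
    rw [← LinearMap.comp_assoc, ih, LinearMap.comp_assoc, bd_comp_bd, LinearMap.comp_zero]

/-- The contracting homotopy of an augmented chain map `D`, built from cones with apices `a`. -/
noncomputable def htpy (a : ∀ n, (Fin (n + 1) → α) → α)
    (D : ∀ n, TupleChain α n →ₗ[ℤ] TupleChain α n) :
    ∀ n, TupleChain α n →ₗ[ℤ] TupleChain α (n + 1)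
  | 0 => 0
  | n + 1 => coneHom (a n) (D (n + 1) - htpy a D n ∘ₗ bd n)

lemma bd_comp_htpy (a : ∀ n, (Fin (n + 1) → α) → α)
    (D : ∀ n, TupleChain α n →ₗ[ℤ] TupleChain α n) (hD0 : D 0 = 0)
    (hD : ∀ n, bd n ∘ₗ D (n + 1) = D n ∘ₗ bd n) (n : ℕ) :
    bd (n + 1) ∘ₗ htpy a D (n + 1) = D (n + 1) - htpy a D n ∘ₗ bd n := by
  induction n with
  | zero =>
    refine bd_comp_coneHom _ _ ?_
    simp [htpy, hD, hD0]
  | succ n ih =>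
    refine bd_comp_coneHom _ _ ?_
    rw [LinearMap.comp_sub, hD, ← LinearMap.comp_assoc, ih, LinearMap.sub_comp,
      LinearMap.comp_assoc (bd (n + 1)), bd_comp_bd, LinearMap.comp_zero, sub_zero, sub_self]

end TupleChain

/-! ### Simplices with supports and their cochains -/

/-- A family of tuples of open sets closed under faces, every tuple carrying a support on which
sections are taken; tuples are indexed by their number of vertices. -/
structure SupportedTuples (X : Type u) [TopologicalSpace X] where
  mem : ∀ n, (Fin n → Opens X) → Prop
  supp : ∀ n, (Fin n → Opens X) → Opens X
  mem_face : ∀ {n} {s : Fin (n + 1) → Opens X} (i : Fin (n + 1)),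
    mem (n + 1) s → mem n (s ∘ i.succAbove)
  supp_le_face : ∀ {n} {s : Fin (n + 1) → Opens X} (i : Fin (n + 1)),
    mem (n + 1) s → supp (n + 1) s ≤ supp n (s ∘ i.succAbove)

namespace SupportedTuples

open TupleChain

variable {S T R : SupportedTuples X} {F : Presheaf'.{u, v} X}

/-- The chains all of whose simplices belong to `S` and have support containing `W`. -/
def carrier (S : SupportedTuples X) (W : Opens X) (n : ℕ) : Submodule ℤ (TupleChain (Opens X) n) :=
  Finsupp.supported ℤ ℤ {s | S.mem n s ∧ W ≤ S.supp n s}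

lemma single_mem_carrier {W : Opens X} {n : ℕ} {s : Fin n → Opens X} (hs : S.mem n s)
    (hW : W ≤ S.supp n s) : Finsupp.single s 1 ∈ S.carrier W n :=
  Finsupp.single_mem_supported ℤ 1 ⟨hs, hW⟩

lemma carrier_induction {W : Opens X} {n : ℕ} {N : Submodule ℤ (TupleChain (Opens X) n)}
    (h : ∀ s, S.mem n s → W ≤ S.supp n s → Finsupp.single s 1 ∈ N) : S.carrier W n ≤ N := by
  rw [carrier, Finsupp.supported_eq_span_single, Submodule.span_le]
  rintro _ ⟨s, hs, rfl⟩
  exact h s hs.1 hs.2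

lemma carrier_anti {W W' : Opens X} (h : W' ≤ W) (n : ℕ) : S.carrier W n ≤ S.carrier W' n :=
  carrier_induction fun _ hs hW => single_mem_carrier hs (h.trans hW)

/-- Linear maps sending each simplex of `S` to a chain of `T` with at least the same support. -/
def Carried (S T : SupportedTuples X) {n m : ℕ}
    (f : TupleChain (Opens X) n →ₗ[ℤ] TupleChain (Opens X) m) : Prop :=
  ∀ s, S.mem n s → f (Finsupp.single s 1) ∈ T.carrier (S.supp n s) m

namespace Carried

variable {n m k : ℕ} {f g : TupleChain (Opens X) n →ₗ[ℤ] TupleChain (Opens X) m}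

lemma map_mem (hf : Carried S T f) {W : Opens X} {x : TupleChain (Opens X) n}
    (hx : x ∈ S.carrier W n) : f x ∈ T.carrier W m :=
  carrier_induction (N := (T.carrier W m).comap f)
    (fun s hs hW => carrier_anti hW m (hf s hs)) hx

protected lemma id : Carried S S (LinearMap.id : TupleChain (Opens X) n →ₗ[ℤ] _) :=
  fun _ hs => single_mem_carrier hs le_rfl

protected lemma zero : Carried S T (0 : TupleChain (Opens X) n →ₗ[ℤ] TupleChain (Opens X) m) :=
  fun _ _ => Submodule.zero_mem _

lemma sub (hf : Carried S T f) (hg : Carried S T g) : Carried S T (f - g) :=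
  fun s hs => Submodule.sub_mem _ (hf s hs) (hg s hs)

lemma comp {h : TupleChain (Opens X) m →ₗ[ℤ] TupleChain (Opens X) k}
    (hh : Carried T R h) (hf : Carried S T f) : Carried S R (h ∘ₗ f) :=
  fun s hs => hh.map_mem (hf s hs)

lemma bd : Carried S S (bd n) := fun s hs => by
  rw [bd_single]
  exact Submodule.sum_mem _ fun i _ => Submodule.smul_mem _ _
    (single_mem_carrier (S.mem_face i hs) (S.supp_le_face i hs))

end Carried

/-- The apices `a` can be used to cone off chains of `T` over the supports of simplices of `S`. -/
def HasCones (S T : SupportedTuples X) (a : ∀ n, (Fin (n + 1) → Opens X) → Opens X) : Prop :=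
  ∀ n s, S.mem (n + 1) s → ∀ m t, T.mem m t → S.supp (n + 1) s ≤ T.supp m t →
    T.mem (m + 1) (Fin.cons (a n s) t) ∧
      S.supp (n + 1) s ≤ T.supp (m + 1) (Fin.cons (a n s) t)

section Cones

variable {a : ∀ n, (Fin (n + 1) → Opens X) → Opens X}

lemma HasCones.coneHom (ha : HasCones S T a) {n m : ℕ}
    {g : TupleChain (Opens X) (n + 1) →ₗ[ℤ] TupleChain (Opens X) m} (hg : Carried S T g) :
    Carried S T (coneHom (a n) g) := fun s hs => by
  rw [coneHom_single]
  refine carrier_induction (N := (T.carrier _ (m + 1)).comap (cone (a n s) m))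
    (fun t ht hW => ?_) (hg s hs)
  rw [Submodule.mem_comap, cone_single]
  obtain ⟨h₁, h₂⟩ := ha n s hs m t ht hW
  exact single_mem_carrier h₁ h₂

lemma HasCones.sd (ha : HasCones S T a)
    (h0 : Carried S T (LinearMap.id (M := TupleChain (Opens X) 0)))
    (n : ℕ) : Carried S T (sd a n) := by
  induction n with
  | zero => exact h0
  | succ n ih => exact ha.coneHom (ih.comp .bd)

lemma HasCones.htpy (ha : HasCones S S a)
    {D : ∀ n, TupleChain (Opens X) n →ₗ[ℤ] TupleChain (Opens X) n}
    (hD : ∀ n, Carried S S (D (n + 1))) (n : ℕ) : Carried S S (htpy a D n) := by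
  induction n with
  | zero => exact .zero
  | succ n ih => exact ha.coneHom ((hD _).sub (ih.comp .bd))

end Cones

/-- Cochains on the nonempty tuples of `S`, with values in sections over the supports. -/
def Cochain (S : SupportedTuples X) (F : Presheaf'.{u, v} X) (n : ℕ) : Type (max u v) :=
  ∀ s : {s : Fin (n + 1) → Opens X // S.mem (n + 1) s}, F.obj (S.supp (n + 1) s.1)

noncomputable instance (S : SupportedTuples X) (F : Presheaf'.{u, v} X) (n : ℕ) :
    AddCommGroup (S.Cochain F n) := Pi.addCommGroup

/-- Restriction as a linear map. -/
def _root_.Presheaf'.resHom (F : Presheaf'.{u, v} X) {U V : Opens X} (h : V ≤ U) :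
    F.obj U →ₗ[ℤ] F.obj V :=
  (AddMonoidHom.mk' (F.res h) (F.res_add h)).toIntLinearMap

open Classical in
/-- Evaluation of a cochain on chains, with values in the sections over `W`; simplices outside
`S.carrier W` are ignored. -/
noncomputable def eval {n : ℕ} (c : S.Cochain F n) (W : Opens X) :
    TupleChain (Opens X) (n + 1) →ₗ[ℤ] F.obj W :=
  Finsupp.linearCombination ℤ fun s =>
    if h : S.mem (n + 1) s ∧ W ≤ S.supp (n + 1) s then F.res h.2 (c ⟨s, h.1⟩) else 0

lemma eval_single {n : ℕ} (c : S.Cochain F n) {W : Opens X} {s : Fin (n + 1) → Opens X}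
    (hs : S.mem (n + 1) s) (hW : W ≤ S.supp (n + 1) s) :
    eval c W (Finsupp.single s 1) = F.res hW (c ⟨s, hs⟩) := by
  simp [eval, hs, hW]

lemma eval_add {n : ℕ} (c d : S.Cochain F n) (W : Opens X) :
    eval (c + d) W = eval c W + eval d W := by
  refine hom_ext fun s => ?_
  by_cases h : S.mem (n + 1) s ∧ W ≤ S.supp (n + 1) s
  · rw [LinearMap.add_apply, eval_single _ h.1 h.2, eval_single _ h.1 h.2,
      eval_single _ h.1 h.2]
    exact F.res_add _ _ _
  · simp [eval, h]

lemma res_eval {n : ℕ} (c : S.Cochain F n) {W W' : Opens X} (h : W' ≤ W)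
    {x : TupleChain (Opens X) (n + 1)} (hx : x ∈ S.carrier W (n + 1)) :
    F.res h (eval c W x) = eval c W' x := by
  refine carrier_induction
    (N := LinearMap.eqLocus (F.resHom h ∘ₗ eval c W) (eval c W')) (fun s hs hW => ?_) hx
  rw [LinearMap.mem_eqLocus, LinearMap.comp_apply, eval_single c hs hW,
    eval_single c hs (h.trans hW)]
  exact F.res_comp _ _ _

/-- The map on cochains dual to a linear map of chains. -/
noncomputable def pull (S T : SupportedTuples X) {n m : ℕ}
    (f : TupleChain (Opens X) (n + 1) →ₗ[ℤ] TupleChain (Opens X) (m + 1)) (c : T.Cochain F m) :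
    S.Cochain F n :=
  fun s => eval c (S.supp (n + 1) s.1) (f (Finsupp.single s.1 1))

section Pull

variable {n m k : ℕ} {f : TupleChain (Opens X) (n + 1) →ₗ[ℤ] TupleChain (Opens X) (m + 1)}

lemma pull_add (f : TupleChain (Opens X) (n + 1) →ₗ[ℤ] TupleChain (Opens X) (m + 1))
    (c d : T.Cochain F m) : pull S T f (c + d) = pull S T f c + pull S T f d := by
  funext s
  exact LinearMap.congr_fun (eval_add c d (S.supp (n + 1) s.1)) (f (Finsupp.single s.1 1))

lemma add_pull (f g : TupleChain (Opens X) (n + 1) →ₗ[ℤ] TupleChain (Opens X) (m + 1))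
    (c : T.Cochain F m) : pull S T (f + g) c = pull S T f c + pull S T g c :=
  funext fun _ => map_add _ _ _

lemma sub_pull (f g : TupleChain (Opens X) (n + 1) →ₗ[ℤ] TupleChain (Opens X) (m + 1))
    (c : T.Cochain F m) : pull S T (f - g) c = pull S T f c - pull S T g c :=
  funext fun _ => map_sub _ _ _

lemma id_pull (c : S.Cochain F n) : pull S S LinearMap.id c = c := by
  funext s
  exact (eval_single c s.2 le_rfl).trans (F.res_id _)

lemma pull_pull {h : TupleChain (Opens X) (m + 1) →ₗ[ℤ] TupleChain (Opens X) (k + 1)}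
    (hf : Carried S T f) (hh : Carried T R h) (c : R.Cochain F k) :
    pull S T f (pull T R h c) = pull S R (h ∘ₗ f) c := by
  funext s
  refine carrier_induction (N := LinearMap.eqLocus (eval (pull T R h c) (S.supp (n + 1) s.1))
    (eval c (S.supp (n + 1) s.1) ∘ₗ h)) (fun t ht hW => ?_) (hf s.1 s.2)
  rw [LinearMap.mem_eqLocus, eval_single _ ht hW]
  exact res_eval c hW (hh t ht)

lemma pull_bd_comm {f : ∀ n, TupleChain (Opens X) n →ₗ[ℤ] TupleChain (Opens X) n}
    (hf : ∀ n, Carried S T (f (n + 1))) (hbd : ∀ n, bd n ∘ₗ f (n + 1) = f n ∘ₗ bd n)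
    (c : T.Cochain F n) :
    pull S T (f (n + 2)) (pull T T (bd (n + 1)) c) =
      pull S S (bd (n + 1)) (pull S T (f (n + 1)) c) := by
  rw [pull_pull (hf _) .bd, pull_pull .bd (hf _), hbd]

lemma pull_bd_apply (c : S.Cochain F n) (s : {s // S.mem (n + 2) s}) :
    pull S S (bd (n + 1)) c s = ∑ i : Fin (n + 2), ((-1 : ℤ) ^ (i : ℕ)) •
      F.res (S.supp_le_face i s.2) (c ⟨s.1 ∘ i.succAbove, S.mem_face i s.2⟩) := by
  rw [pull, bd_single, map_sum]
  refine Finset.sum_congr rfl fun i _ => ?_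
  rw [map_smul, eval_single c (S.mem_face i s.2) (S.supp_le_face i s.2)]

/-- A carried augmented chain map induces a map of cochains homotopic to the identity, provided
cones are available over all supports. -/
lemma exists_cochain_homotopy (F : Presheaf'.{u, v} X)
    {a : ∀ n, (Fin (n + 1) → Opens X) → Opens X} (ha : HasCones S S a)
    {e : ∀ n, TupleChain (Opens X) n →ₗ[ℤ] TupleChain (Opens X) n}
    (he : ∀ n, Carried S S (e (n + 1))) (he0 : e 0 = LinearMap.id)
    (hbd : ∀ n, TupleChain.bd n ∘ₗ e (n + 1) = e n ∘ₗ TupleChain.bd n) :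
    ∃ H : ∀ n, S.Cochain F (n + 1) → S.Cochain F n,
      (∀ n c d, H n (c + d) = H n c + H n d) ∧
      (∀ c : S.Cochain F 0, H 0 (pull S S (bd 1) c) = c - pull S S (e 1) c) ∧
      ∀ n (c : S.Cochain F (n + 1)),
        H (n + 1) (pull S S (bd (n + 2)) c) + pull S S (bd (n + 1)) (H n c) =
          c - pull S S (e (n + 2)) c := by
  let D n := LinearMap.id - e n
  have hD0 : D 0 = 0 := by simp [D, he0]
  have hD n : bd n ∘ₗ D (n + 1) = D n ∘ₗ bd n := by
    simp [D, LinearMap.comp_sub, LinearMap.sub_comp, hbd]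
  have hh := ha.htpy (D := D) fun n => Carried.id.sub (he n)
  have hbh := bd_comp_htpy a D hD0 hD
  refine ⟨fun n => pull S S (TupleChain.htpy a D (n + 1)), fun n => pull_add _, fun c => ?_,
    fun n c => ?_⟩
  · beta_reduce
    rw [pull_pull (hh _) .bd, hbh, TupleChain.htpy, LinearMap.zero_comp, sub_zero, sub_pull,
      id_pull]
  · beta_reduce
    rw [pull_pull (hh _) .bd, pull_pull .bd (hh _), ← add_pull, hbh, sub_add_cancel, sub_pull,
      id_pull]

end Pull

/-- The simplices of `K(𝒰)`, supported on their intersections. -/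
def cech (𝒰 : Set (Opens X)) : SupportedTuples X where
  mem _ u := (∀ i, u i ∈ 𝒰) ∧ (⋂ i, (u i : Set X)).Nonempty
  supp _ u := ⨅ i, u i
  mem_face i hu := ⟨fun _ => hu.1 _,
    hu.2.mono (Set.iInter_mono' fun j => ⟨i.succAbove j, subset_rfl⟩)⟩
  supp_le_face _ _ := le_iInf fun _ => iInf_le _ _

/-- The support of a chain of open sets: its first member. -/
def chainSupp : ∀ n, (Fin n → Opens X) → Opens X
  | 0, _ => ⊤
  | _ + 1, v => v 0

/-- The simplices of `N(𝒰)`, supported on their first vertices. -/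
def nerve (𝒰 : Set (Opens X)) : SupportedTuples X where
  mem _ v := (∀ i, memA 𝒰 (v i)) ∧ Monotone v
  supp := chainSupp
  mem_face i hv := ⟨fun _ => hv.1 _, hv.2.comp (Fin.strictMono_succAbove i).monotone⟩
  supp_le_face {n} _ i hv := by
    cases n with
    | zero => exact le_top
    | succ n => exact hv.2 (Fin.zero_le _)

variable {𝒰 : Set (Opens X)}

lemma le_chainSupp_iff {n : ℕ} {v : Fin n → Opens X} (hv : Monotone v) {W : Opens X} :
    W ≤ chainSupp n v ↔ ∀ i, W ≤ v i := by
  cases n with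
  | zero => simp [chainSupp]
  | succ n => exact ⟨fun h i => h.trans (hv (Fin.zero_le i)), fun h => h 0⟩

lemma memA_iInf {n : ℕ} {u : Fin (n + 1) → Opens X} (hu : (cech 𝒰).mem (n + 1) u) :
    memA 𝒰 (⨅ i, u i) := by
  classical
  refine ⟨⟨Finset.univ.image u, ?_, Finset.univ_nonempty.image u, ?_⟩, ?_⟩
  · simpa [Set.range_subset_iff] using hu.1
  · rw [Finset.inf_image, Function.id_comp, Finset.inf_univ_eq_iInf]
  · rw [Opens.coe_iInf]
    exact hu.2

lemma nerve_cons {W : Opens X} (hW : memA 𝒰 W) {n : ℕ} {v : Fin n → Opens X}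
    (hv : (nerve 𝒰).mem n v) (hWv : W ≤ (nerve 𝒰).supp n v) :
    (nerve 𝒰).mem (n + 1) (Fin.cons W v) ∧
      W ≤ (nerve 𝒰).supp (n + 1) (Fin.cons W v) := by
  refine ⟨⟨Fin.cases hW hv.1, ?_⟩, le_rfl⟩
  have hle := (le_chainSupp_iff hv.2).1 hWv
  intro i j hij
  cases i using Fin.cases with
  | zero => cases j using Fin.cases with
    | zero => rfl
    | succ j => simpa using hle j
  | succ i => cases j using Fin.cases with
    | zero => simp at hij
    | succ j => simpa using hv.2 (Fin.succ_le_succ_iff.1 hij)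

lemma cech_cons {W U : Opens X} (hW : (W : Set X).Nonempty) (hU : U ∈ 𝒰) (hWU : W ≤ U) {n : ℕ}
    {u : Fin n → Opens X} (hu : (cech 𝒰).mem n u) (hWu : W ≤ (cech 𝒰).supp n u) :
    (cech 𝒰).mem (n + 1) (Fin.cons U u) ∧ W ≤ (cech 𝒰).supp (n + 1) (Fin.cons U u) := by
  have hle : ∀ i, W ≤ (Fin.cons U u : Fin (n + 1) → Opens X) i :=
    Fin.cases hWU fun i => hWu.trans (iInf_le u i)
  refine ⟨⟨Fin.cases hU hu.1, ?_⟩, le_iInf hle⟩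
  obtain ⟨x, hx⟩ := hW
  exact ⟨x, Set.mem_iInter.2 fun i => hle i hx⟩

lemma hasCones_cech_nerve : HasCones (cech 𝒰) (nerve 𝒰) fun _ u => ⨅ i, u i :=
  fun _ _ hu _ _ hv hle => nerve_cons (memA_iInf hu) hv hle

lemma hasCones_nerve : HasCones (nerve 𝒰) (nerve 𝒰) fun _ v => v 0 :=
  fun _ _ hw _ _ hv hle => nerve_cons (hw.1 0) hv hle

lemma hasCones_cech {p : Opens X → Opens X} (hp : ∀ V, memA 𝒰 V → p V ∈ 𝒰 ∧ V ≤ p V) :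
    HasCones (cech 𝒰) (cech 𝒰) fun _ u => p (⨅ i, u i) := fun _ _ hw _ _ hu hle =>
  have h := memA_iInf hw
  cech_cons h.2 (hp _ h).1 (hp _ h).2 hu hle

lemma carried_id_zero :
    Carried (cech 𝒰) (nerve 𝒰) (LinearMap.id (M := TupleChain (Opens X) 0)) :=
  fun _ _ => single_mem_carrier ⟨fun i => i.elim0, fun i => i.elim0⟩ le_top

lemma carried_map {p : Opens X → Opens X} (hp : ∀ V, memA 𝒰 V → p V ∈ 𝒰 ∧ V ≤ p V) (n : ℕ) :
    Carried (nerve 𝒰) (cech 𝒰) (TupleChain.map p (n + 1)) := fun v hv => by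
  rw [map_single]
  exact single_mem_carrier (piSimp p hp ⟨v, hv⟩).2 (le_iInf_piSimp p hp ⟨v, hv⟩)

lemma deltaK_eq_pull (F : Presheaf'.{u, v} X) (n : ℕ) :
    deltaK F 𝒰 n = pull (F := F) (cech 𝒰) (cech 𝒰) (bd (n + 1)) :=
  funext fun c => funext fun s => (pull_bd_apply (S := cech 𝒰) c s).symm

lemma deltaN_eq_pull (F : Presheaf'.{u, v} X) (n : ℕ) :
    deltaN F 𝒰 n = pull (F := F) (nerve 𝒰) (nerve 𝒰) (bd (n + 1)) :=
  funext fun c => funext fun s => (pull_bd_apply (S := nerve 𝒰) c s).symm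

lemma piStar_eq_pull {p : Opens X → Opens X} (hp : ∀ V, memA 𝒰 V → p V ∈ 𝒰 ∧ V ≤ p V)
    (F : Presheaf'.{u, v} X) (n : ℕ) :
    piStar p hp F n = pull (F := F) (nerve 𝒰) (cech 𝒰) (TupleChain.map p (n + 1)) := by
  funext c v
  refine (eval_single (S := cech 𝒰) c (piSimp p hp v).2 (le_iInf_piSimp p hp v)).symm.trans ?_
  exact congrArg _ (map_single p _ v.1).symm

end SupportedTuples

open SupportedTuples in
/-- Let `𝒰` be an open covering of `X`, `F` a presheaf of abelian
groups on `X`, and `π : 𝒜(𝒰) → 𝒰` a map with `V ⊆ π(V)` and `π(U) = U` for `U ∈ 𝒰`.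
Then the induced chain map `π^* : C^•(K(𝒰); F^∨) → C^•(N(𝒰); F_*)` is a homotopy
equivalence of cochain complexes: there is a chain map `Sd^•` in the other direction such
that `Sd^• ∘ π^*` and `π^* ∘ Sd^•` are chain homotopic to the identities (in particular,
`π^*` induces an isomorphism in cohomology). -/
theorem piStar_homotopy_equivalence
    (F : Presheaf'.{u, v} X) (𝒰 : Set (Opens X))
    (p : Opens X → Opens X)
    (hp : ∀ V : Opens X, memA 𝒰 V → p V ∈ 𝒰 ∧ V ≤ p V)
    (hpU : ∀ U ∈ 𝒰, p U = U) :
    -- `π^*` is a chain map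
    (∀ (n : ℕ) (c : KCochain F 𝒰 n),
      piStar p hp F (n + 1) (deltaK F 𝒰 n c) = deltaN F 𝒰 n (piStar p hp F n c)) ∧
    -- and it admits a homotopy inverse `Sd`
    ∃ Sd : ∀ n : ℕ, NCochain F 𝒰 n → KCochain F 𝒰 n,
      (∀ (n : ℕ) (c d : NCochain F 𝒰 n), Sd n (c + d) = Sd n c + Sd n d) ∧
      (∀ (n : ℕ) (c : NCochain F 𝒰 n), Sd (n + 1) (deltaN F 𝒰 n c) = deltaK F 𝒰 n (Sd n c)) ∧
      (∃ HK : ∀ n : ℕ, KCochain F 𝒰 (n + 1) → KCochain F 𝒰 n,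
        (∀ (n : ℕ) (c d : KCochain F 𝒰 (n + 1)), HK n (c + d) = HK n c + HK n d) ∧
        (∀ c : KCochain F 𝒰 0,
          HK 0 (deltaK F 𝒰 0 c) = c - Sd 0 (piStar p hp F 0 c)) ∧
        (∀ (n : ℕ) (c : KCochain F 𝒰 (n + 1)),
          HK (n + 1) (deltaK F 𝒰 (n + 1) c) + deltaK F 𝒰 n (HK n c) =
            c - Sd (n + 1) (piStar p hp F (n + 1) c))) ∧
      (∃ HN : ∀ n : ℕ, NCochain F 𝒰 (n + 1) → NCochain F 𝒰 n,
        (∀ (n : ℕ) (c d : NCochain F 𝒰 (n + 1)), HN n (c + d) = HN n c + HN n d) ∧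
        (∀ c : NCochain F 𝒰 0,
          HN 0 (deltaN F 𝒰 0 c) = c - piStar p hp F 0 (Sd 0 c)) ∧
        (∀ (n : ℕ) (c : NCochain F 𝒰 (n + 1)),
          HN (n + 1) (deltaN F 𝒰 (n + 1) c) + deltaN F 𝒰 n (HN n c) =
            c - piStar p hp F (n + 1) (Sd (n + 1) c))) := by
  let a : ∀ n, (Fin (n + 1) → Opens X) → Opens X := fun _ u => ⨅ i, u i
  have hSd : ∀ n, Carried (cech 𝒰) (nerve 𝒰) (TupleChain.sd a n) :=
    hasCones_cech_nerve.sd carried_id_zero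
  have hbSd := TupleChain.bd_comp_sd a
  have hmap := carried_map hp
  have hbmap := TupleChain.bd_comp_map p
  obtain ⟨HK, hK_add, hK_zero, hK_succ⟩ := exists_cochain_homotopy F (hasCones_cech hp)
    (e := fun n => TupleChain.map p n ∘ₗ TupleChain.sd a n) (fun n => (hmap n).comp (hSd _))
    (by rw [TupleChain.map_zero_eq_id]; rfl)
    fun n => by rw [← LinearMap.comp_assoc, hbmap, LinearMap.comp_assoc, hbSd, LinearMap.comp_assoc]
  obtain ⟨HN, hN_add, hN_zero, hN_succ⟩ := exists_cochain_homotopy F (hasCones_nerve (𝒰 := 𝒰))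
    (e := fun n => TupleChain.sd a n ∘ₗ TupleChain.map p n) (fun n => (hSd _).comp (hmap n))
    (by rw [TupleChain.map_zero_eq_id]; rfl)
    fun n => by rw [← LinearMap.comp_assoc, hbSd, LinearMap.comp_assoc, hbmap, LinearMap.comp_assoc]
  simp only [deltaK_eq_pull, deltaN_eq_pull, piStar_eq_pull]
  let K := cech 𝒰
  let N := nerve 𝒰
  refine ⟨fun n c => pull_bd_comm (S := N) (T := K) hmap hbmap c,
    fun n => pull (F := F) K N (TupleChain.sd a (n + 1)),
    fun n => pull_add (S := K) (T := N) _,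
    fun n c => pull_bd_comm (S := K) (T := N) (fun n => hSd (n + 1)) hbSd c,
    ⟨HK, hK_add, fun c => (hK_zero c).trans ?_, fun n c => (hK_succ n c).trans ?_⟩,
    HN, hN_add, fun c => (hN_zero c).trans ?_, fun n c => (hN_succ n c).trans ?_⟩
  · exact congrArg (c - ·) (pull_pull (S := K) (T := N) (R := K) (hSd _) (hmap _) c).symm
  · exact congrArg (c - ·) (pull_pull (S := K) (T := N) (R := K) (hSd _) (hmap _) c).symm
  · exact congrArg (c - ·) (pull_pull (S := N) (T := K) (R := N) (hmap _) (hSd _) c).symm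
  · exact congrArg (c - ·) (pull_pull (S := N) (T := K) (R := N) (hmap _) (hSd _) c).symm
end
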